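/- There exist constants C, C' > 0 such that for all l ≥ 2, C' (log l)/l² ≤ ∫_0^1 P_l(t)^4 dt ≤ C (log l)/l², where P_l is the Legendre polynomial of degree l with P_l(1)=1. -/

import Mathlib

open Polynomial intervalIntegral

noncomputable def legendreP (l : ℕ) : Polynomial ℝ :=
  Polynomial.C (1 / (2 ^ l * (Nat.factorial l) : ℝ)) *
    (⇑Polynomial.derivative)^[l] ((Polynomial.X ^ 2 - 1) ^ l)

theorem iterate_derivative_X_sq_sub_one_pow (l m : ℕ) :
    (X ^ 2 - 1 : ℝ[X]) * derivative^[m + 2] ((X ^ 2 - 1) ^ l)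
      + C (2 * (m + 1 - l) : ℝ) * X * derivative^[m + 1] ((X ^ 2 - 1) ^ l)
      + C ((m + 1) * (m - 2 * l) : ℝ) * derivative^[m] ((X ^ 2 - 1) ^ l) = 0 := by
  induction m with
  | zero =>
    have h : (X ^ 2 - 1 : ℝ[X]) * derivative ((X ^ 2 - 1) ^ l)
        = C (2 * l : ℝ) * X * (X ^ 2 - 1) ^ l := by
      cases l with
      | zero => simp
      | succ l =>
        simp only [derivative_pow_succ, derivative_sub, derivative_X, derivative_one, map_mul,
          map_add, map_one, map_natCast, map_ofNat]
        push_cast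
        ring
    have h' := congrArg derivative h
    simp only [derivative_mul, derivative_sub, derivative_X_pow, derivative_one, derivative_C,
      derivative_X] at h'
    simp only [Function.iterate_succ, Function.iterate_zero, Function.comp, id, map_mul, map_sub,
      map_add, map_one, map_natCast, map_ofNat] at h' ⊢
    simp at h' ⊢
    linear_combination h'
  | succ m ih =>
    have h' := congrArg derivative ih
    simp only [derivative_mul, derivative_add, derivative_sub, derivative_X_pow, derivative_one,
      derivative_C, derivative_X, ← Function.iterate_succ_apply' derivative] at h'
    simp only [map_mul, map_sub, map_add, map_one, map_natCast, map_ofNat] at h' ⊢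
    simp at h' ⊢
    linear_combination h'

theorem legendreP_ode (l : ℕ) (t : ℝ) :
    (1 - t ^ 2) * (legendreP l).derivative.derivative.eval t
      = 2 * t * (legendreP l).derivative.eval t - l * (l + 1) * (legendreP l).eval t := by
  have h := congrArg (eval t) (iterate_derivative_X_sq_sub_one_pow l l)
  simp only [Function.iterate_succ_apply', eval_add, eval_mul, eval_sub, eval_pow, eval_X,
    eval_C, eval_one, eval_zero] at h
  simp only [legendreP, derivative_C_mul, eval_mul, eval_C]
  linear_combination (-(1 / (2 ^ l * (Nat.factorial l) : ℝ))) * h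

theorem legendreP_eval_one (l : ℕ) : (legendreP l).eval 1 = 1 := by
  have h : (hasseDeriv l ((X ^ 2 - 1 : ℝ[X]) ^ l)).eval 1 = 2 ^ l := by
    rw [← taylor_coeff]
    have : taylor 1 ((X ^ 2 - 1 : ℝ[X]) ^ l) = (X + C 2) ^ l * X ^ l := by
      rw [← mul_pow]
      simp only [taylor_apply, pow_comp, sub_comp, X_comp, one_comp]
      congr 1
      simp only [map_one, map_ofNat]
      ring
    rw [this]
    have h2 := coeff_mul_X_pow ((X + C (2 : ℝ)) ^ l) l 0
    rw [zero_add] at h2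
    rw [h2, coeff_zero_eq_eval_zero]
    simp
  rw [legendreP, ← factorial_smul_hasseDeriv]
  rw [eval_mul, eval_C, LinearMap.smul_apply, eval_smul, h, nsmul_eq_mul]
  have := Nat.factorial_ne_zero l
  field_simp

/-- A solution `p` (with derivatives `p₁`, `p₂`) of Legendre's equation of eigenvalue `Λ`,
normalized at `1`. -/
structure IsLegendreSolution (Λ : ℝ) (p p₁ p₂ : ℝ → ℝ) : Prop where
  six_le : 6 ≤ Λ
  hasDerivAt : ∀ t, HasDerivAt p (p₁ t) t
  hasDerivAt' : ∀ t, HasDerivAt p₁ (p₂ t) t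
  ode : ∀ t, (1 - t ^ 2) * p₂ t = 2 * t * p₁ t - Λ * p t
  eval_one : p 1 = 1

namespace IsLegendreSolution

theorem of_legendreP {l : ℕ} (hl : 2 ≤ l) :
    IsLegendreSolution (l * (l + 1)) (fun t => (legendreP l).eval t)
      (fun t => (legendreP l).derivative.eval t)
      (fun t => (legendreP l).derivative.derivative.eval t) where
  six_le := by
    have : (2 : ℝ) ≤ l := by exact_mod_cast hl
    nlinarith
  hasDerivAt t := (legendreP l).hasDerivAt t
  hasDerivAt' t := (legendreP l).derivative.hasDerivAt t
  ode := legendreP_ode l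
  eval_one := legendreP_eval_one l

/-- The weight `(Λ + 1/4) (1 - t²) + 1/4`. -/
noncomputable def weight (Λ t : ℝ) : ℝ := (Λ + 1 / 4) * (1 - t ^ 2) + 1 / 4

/-- The derivative, up to sign and a power of `1 - t²`, of `(1 - t²)^(1/4) p` in the
angle `arccos t`. -/
noncomputable def velocity (p p₁ : ℝ → ℝ) (t : ℝ) : ℝ := (1 - t ^ 2) * p₁ t - t * p t / 2

/-- The Sonin-type energy of `(1 - t²)^(1/4) p`, up to a power of `1 - t²`. -/
noncomputable def energy (Λ : ℝ) (p p₁ : ℝ → ℝ) (t : ℝ) : ℝ :=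
  weight Λ t * p t ^ 2 + velocity p p₁ t ^ 2

variable {Λ : ℝ} {p p₁ p₂ : ℝ → ℝ}

theorem hasDerivAt_one_sub_sq (t : ℝ) : HasDerivAt (fun t : ℝ => 1 - t ^ 2) (-(2 * t)) t := by
  simpa using (hasDerivAt_pow 2 t).const_sub 1

theorem hasDerivAt_weight (Λ t : ℝ) :
    HasDerivAt (weight Λ) (-(2 * (Λ + 1 / 4) * t)) t := by
  refine (((hasDerivAt_one_sub_sq t).const_mul (Λ + 1 / 4)).add_const (1 / 4)).congr_deriv ?_
  ring

theorem hasDerivAt_velocity (h : IsLegendreSolution Λ p p₁ p₂) (t : ℝ) :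
    HasDerivAt (velocity p p₁) (-(Λ * p t) - p t / 2 - t * p₁ t / 2) t := by
  refine (((hasDerivAt_one_sub_sq t).mul (h.hasDerivAt' t)).sub
    (((hasDerivAt_id' t).mul (h.hasDerivAt t)).div_const 2)).congr_deriv ?_
  linear_combination h.ode t

theorem hasDerivAt_energy (h : IsLegendreSolution Λ p p₁ p₂) (t : ℝ) :
    HasDerivAt (energy Λ p p₁)
      (-(t * (Λ * p t ^ 2 + (1 - t ^ 2) * p₁ t ^ 2 - t * p t * p₁ t))) t := by
  refine (((hasDerivAt_weight Λ t).mul ((h.hasDerivAt t).pow 2)).add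
    ((h.hasDerivAt_velocity t).pow 2)).congr_deriv ?_
  simp only [weight, velocity, Pi.pow_apply]
  push_cast
  ring

theorem one_sub_sq_mul_deriv_energy (Λ : ℝ) (p p₁ : ℝ → ℝ) (t : ℝ) :
    (1 - t ^ 2) * (-(t * (Λ * p t ^ 2 + (1 - t ^ 2) * p₁ t ^ 2 - t * p t * p₁ t)))
      = t * (p t ^ 2 / 2 - energy Λ p p₁ t) := by
  simp only [energy, weight, velocity]
  ring

theorem quarter_le_weight (hΛ : 0 ≤ Λ) {t : ℝ} (ht : t ∈ Set.Icc (0 : ℝ) 1) :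
    1 / 4 ≤ weight Λ t := by
  have : 0 ≤ 1 - t ^ 2 := by nlinarith [ht.1, ht.2]
  unfold weight
  nlinarith [mul_nonneg hΛ this]

theorem energy_nonneg (hΛ : 0 ≤ Λ) {t : ℝ} (ht : t ∈ Set.Icc (0 : ℝ) 1) :
    0 ≤ energy Λ p p₁ t := by
  have := quarter_le_weight hΛ ht
  unfold energy
  positivity

theorem monotoneOn_of_hasDerivAt {f f' : ℝ → ℝ} {a b : ℝ}
    (hf : ∀ t ∈ Set.Icc a b, HasDerivAt f (f' t) t) (hf' : ∀ t ∈ Set.Icc a b, 0 ≤ f' t) :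
    MonotoneOn f (Set.Icc a b) :=
  monotoneOn_of_hasDerivWithinAt_nonneg (convex_Icc a b)
    (fun t ht => (hf t ht).continuousAt.continuousWithinAt)
    (fun t ht => (hf t (interior_subset ht)).hasDerivWithinAt)
    (fun t ht => hf' t (interior_subset ht))

theorem sq_add_le (h : IsLegendreSolution Λ p p₁ p₂) {t : ℝ} (ht : t ∈ Set.Icc (0 : ℝ) 1) :
    Λ * p t ^ 2 + (1 - t ^ 2) * p₁ t ^ 2 ≤ Λ := by
  have hm : MonotoneOn (fun t => Λ * p t ^ 2 + (1 - t ^ 2) * p₁ t ^ 2) (Set.Icc 0 1) := by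
    refine monotoneOn_of_hasDerivAt (f' := fun t => 2 * t * p₁ t ^ 2) (fun t _ => ?_)
      (fun t ht => mul_nonneg (by linarith [ht.1]) (sq_nonneg _))
    refine ((((h.hasDerivAt t).pow 2).const_mul Λ).add
      ((hasDerivAt_one_sub_sq t).mul ((h.hasDerivAt' t).pow 2))).congr_deriv ?_
    simp only [Pi.pow_apply]
    push_cast
    linear_combination 2 * p₁ t * h.ode t
  simpa [h.eval_one] using hm ht (Set.right_mem_Icc.2 zero_le_one) ht.2

theorem sq_le_one (h : IsLegendreSolution Λ p p₁ p₂) {t : ℝ} (ht : t ∈ Set.Icc (0 : ℝ) 1) :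
    p t ^ 2 ≤ 1 := by
  have h1 := h.sq_add_le ht
  have h2 : 0 ≤ 1 - t ^ 2 := by nlinarith [ht.1, ht.2]
  have h3 := mul_nonneg h2 (sq_nonneg (p₁ t))
  nlinarith [h.six_le]

theorem one_sub_le (h : IsLegendreSolution Λ p p₁ p₂) {t : ℝ} (ht : t ∈ Set.Icc (0 : ℝ) 1) :
    1 - Λ * (1 - t) ≤ p t := by
  have hΛ := h.six_le
  have one_mem : (1 : ℝ) ∈ Set.Icc (0 : ℝ) 1 := Set.right_mem_Icc.2 zero_le_one
  have hd : ∀ t ∈ Set.Icc (0 : ℝ) 1, (1 - t ^ 2) * p₁ t ≤ Λ * (1 - t) := by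
    intro t ht
    have hm : MonotoneOn (fun t => (1 - t ^ 2) * p₁ t + Λ * t) (Set.Icc 0 1) := by
      refine monotoneOn_of_hasDerivAt (f' := fun t => Λ * (1 - p t)) (fun t _ => ?_)
        (fun t ht => mul_nonneg (by linarith) (by nlinarith [h.sq_le_one ht]))
      refine (((hasDerivAt_one_sub_sq t).mul (h.hasDerivAt' t)).add
        ((hasDerivAt_id' t).const_mul Λ)).congr_deriv ?_
      linear_combination h.ode t
    have := hm ht one_mem ht.2
    simp only at this
    linarith
  have hm : MonotoneOn (fun t => Λ * t - p t) (Set.Icc t 1) := by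
    refine monotoneOn_of_hasDerivWithinAt_nonneg (f' := fun t => Λ * 1 - p₁ t) (convex_Icc t 1)
      (fun x _ => ?_) (fun x _ => ?_) (fun x hx => ?_)
    · exact (((hasDerivAt_id' x).const_mul Λ).sub
        (h.hasDerivAt x)).continuousAt.continuousWithinAt
    · exact (((hasDerivAt_id' x).const_mul Λ).sub (h.hasDerivAt x)).hasDerivWithinAt
    · rw [interior_Icc] at hx
      have hx0 : 0 ≤ x := ht.1.trans hx.1.le
      have h1 := hd x ⟨hx0, hx.2.le⟩
      have h2 : (1 + x) * p₁ x ≤ Λ := by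
        refine le_of_mul_le_mul_left ?_ (sub_pos.2 hx.2)
        linarith
      rcases le_total (p₁ x) 0 with h3 | h3 <;> nlinarith
  have := hm (Set.left_mem_Icc.2 ht.2) (Set.right_mem_Icc.2 ht.2) ht.2
  simp only [h.eval_one] at this
  linarith

theorem energy_le (h : IsLegendreSolution Λ p p₁ p₂) {t : ℝ} (ht : t ∈ Set.Icc (0 : ℝ) 1) :
    energy Λ p p₁ t ≤ 3 * weight Λ t := by
  have hs : 0 ≤ 1 - t ^ 2 := by nlinarith [ht.1, ht.2]
  have h1 := h.sq_le_one ht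
  have h2 := h.sq_add_le ht
  have hΛ := h.six_le
  have hw := quarter_le_weight (Λ := Λ) (by linarith) ht
  have hv : velocity p p₁ t ^ 2 ≤ 2 * weight Λ t := by
    have e1 : velocity p p₁ t ^ 2 ≤ 2 * ((1 - t ^ 2) * p₁ t) ^ 2 + 2 * (t * p t / 2) ^ 2 := by
      unfold velocity
      nlinarith [sq_nonneg ((1 - t ^ 2) * p₁ t + t * p t / 2)]
    have e2 : ((1 - t ^ 2) * p₁ t) ^ 2 ≤ (1 - t ^ 2) * Λ := by
      have : (1 - t ^ 2) * p₁ t ^ 2 ≤ Λ := by nlinarith [sq_nonneg (p t)]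
      nlinarith [mul_le_mul_of_nonneg_left this hs]
    have e3 : (t * p t) ^ 2 ≤ 1 := by
      rw [mul_pow]
      exact mul_le_one₀ (by linarith) (sq_nonneg _) h1
    unfold weight
    nlinarith
  unfold energy
  nlinarith

theorem monotoneOn_energy_sq_div (h : IsLegendreSolution Λ p p₁ p₂) {a : ℝ} (ha : a < 1) :
    MonotoneOn (fun t => energy Λ p p₁ t ^ 2 / (1 - t ^ 2)) (Set.Icc 0 a) := by
  have hs : ∀ t ∈ Set.Icc 0 a, 0 < 1 - t ^ 2 := fun t ht => by nlinarith [ht.1, ht.2]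
  refine monotoneOn_of_hasDerivAt
    (f' := fun t => t * energy Λ p p₁ t * p t ^ 2 / (1 - t ^ 2) ^ 2) (fun t ht => ?_)
    (fun t ht => ?_)
  · refine (((h.hasDerivAt_energy t).pow 2).div (hasDerivAt_one_sub_sq t)
      (hs t ht).ne').congr_deriv ?_
    simp only [Pi.pow_apply]
    push_cast
    congr 1
    linear_combination 2 * energy Λ p p₁ t * one_sub_sq_mul_deriv_energy Λ p p₁ t
  · have := energy_nonneg (p := p) (p₁ := p₁) (Λ := Λ) (by linarith [h.six_le])
      (⟨ht.1, ht.2.trans ha.le⟩ : t ∈ Set.Icc (0 : ℝ) 1)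
    have := ht.1
    positivity

theorem monotoneOn_neg_energy_sq (h : IsLegendreSolution Λ p p₁ p₂) :
    MonotoneOn (fun t => -((1 - t ^ 2) * energy Λ p p₁ t ^ 2 / weight Λ t ^ 2))
      (Set.Icc 0 1) := by
  have hΛ : 0 ≤ Λ := by linarith [h.six_le]
  have hw : ∀ t ∈ Set.Icc (0 : ℝ) 1, 0 < weight Λ t :=
    fun t ht => by linarith [quarter_le_weight hΛ ht]
  refine monotoneOn_of_hasDerivAt
    (f' := fun t => t * energy Λ p p₁ t * velocity p p₁ t ^ 2 / weight Λ t ^ 3) (fun t ht => ?_)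
    (fun t ht => ?_)
  · have hw' := hw t ht
    refine ((((hasDerivAt_one_sub_sq t).mul ((h.hasDerivAt_energy t).pow 2)).div
      ((hasDerivAt_weight Λ t).pow 2) (pow_pos hw' 2).ne').neg).congr_deriv ?_
    simp only [Pi.pow_apply, Pi.mul_apply]
    push_cast
    have e1 := one_sub_sq_mul_deriv_energy Λ p p₁ t
    have e2 : energy Λ p p₁ t = weight Λ t * p t ^ 2 + velocity p p₁ t ^ 2 := rfl
    have e3 : (Λ + 1 / 4) * (1 - t ^ 2) = weight Λ t - 1 / 4 := by unfold weight; ring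
    set E := energy Λ p p₁ t
    set w := weight Λ t
    set v := velocity p p₁ t
    set E' := -(t * (Λ * p t ^ 2 + (1 - t ^ 2) * p₁ t ^ 2 - t * p t * p₁ t))
    rw [← neg_div, div_eq_div_iff (by positivity) (by positivity)]
    linear_combination (-2 * E * w ^ 5) * e1 + t * E * w ^ 4 * e2 - 4 * t * E ^ 2 * w ^ 4 * e3
  · have h1 := energy_nonneg (p := p) (p₁ := p₁) hΛ ht
    have h2 := hw t ht
    have h3 := ht.1
    positivity

theorem energy_sq_bounds (h : IsLegendreSolution Λ p p₁ p₂) {t : ℝ}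
    (ht : t ∈ Set.Icc (0 : ℝ) 1) :
    weight Λ t / 128 ≤ energy Λ p p₁ t ^ 2 ∧ energy Λ p p₁ t ^ 2 ≤ 41 * weight Λ t := by
  have hΛ := h.six_le
  have hΛ0 : 0 ≤ Λ := by linarith
  obtain ⟨a, ha⟩ : ∃ a, a = 1 - 1 / (2 * Λ) := ⟨_, rfl⟩
  have ha' : Λ * (1 - a) = 1 / 2 := by rw [ha]; field_simp; ring
  have ha1 : a < 1 := by nlinarith
  have ha0 : 0 ≤ a := by nlinarith
  have haI : a ∈ Set.Icc (0 : ℝ) 1 := ⟨ha0, ha1.le⟩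
  have hnear : ∀ x ∈ Set.Icc a 1, weight Λ x ≤ 3 / 2 ∧ weight Λ x / 4 ≤ energy Λ p p₁ x := by
    intro x hx
    have hxI : x ∈ Set.Icc (0 : ℝ) 1 := ⟨ha0.trans hx.1, hx.2⟩
    have h1 : Λ * (1 - x) ≤ 1 / 2 := by nlinarith [hx.1]
    have hw := quarter_le_weight hΛ0 hxI
    refine ⟨?_, ?_⟩
    · unfold weight
      nlinarith [hx.2, hxI.1, mul_nonneg (sub_nonneg.2 hx.2) (sub_nonneg.2 hx.2)]
    · have h2 : 1 / 2 ≤ p x := by linarith [h.one_sub_le hxI]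
      have h3 : 1 / 4 ≤ p x ^ 2 := by nlinarith
      unfold energy
      nlinarith [sq_nonneg (velocity p p₁ x)]
  have hwt := quarter_le_weight hΛ0 ht
  have hEt := energy_nonneg (p := p) (p₁ := p₁) hΛ0 ht
  have hEt3 := h.energy_le ht
  rcases le_total a t with hat | hta
  · obtain ⟨h1, h2⟩ := hnear t ⟨hat, ht.2⟩
    constructor <;> nlinarith
  · obtain ⟨h1, h2⟩ := hnear a ⟨le_rfl, ha1.le⟩
    have hEa3 := h.energy_le haI
    have hsa : 1 / 2 ≤ Λ * (1 - a ^ 2) := by nlinarith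
    have hwa : 3 / 4 ≤ weight Λ a := by unfold weight; nlinarith
    have hsa0 : 0 < 1 - a ^ 2 := by nlinarith
    have hst0 : 0 < 1 - t ^ 2 := by nlinarith [ht.1]
    have hΛp : 0 < Λ := by linarith
    have hup := h.monotoneOn_energy_sq_div ha1 ⟨ht.1, hta⟩ ⟨ha0, le_rfl⟩ hta
    have hlow := h.monotoneOn_neg_energy_sq ht haI hta
    simp only [neg_le_neg_iff] at hup hlow
    have hws : Λ * (1 - t ^ 2) ≤ weight Λ t := by unfold weight; nlinarith
    constructor
    · have hb : 1 / (128 * Λ) ≤ (1 - a ^ 2) * energy Λ p p₁ a ^ 2 / weight Λ a ^ 2 := by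
        have hq : 1 / 16 ≤ energy Λ p p₁ a ^ 2 / weight Λ a ^ 2 := by
          rw [← div_pow]
          have : 1 / 4 ≤ energy Λ p p₁ a / weight Λ a := by
            rw [le_div_iff₀ (by linarith)]; linarith
          nlinarith
        rw [mul_div_assoc, div_le_iff₀ (by positivity)]
        nlinarith
      have hc := hb.trans hlow
      rw [div_le_div_iff₀ (by positivity) (by positivity)] at hc
      have hd : weight Λ t ^ 2 ≤ energy Λ p p₁ t ^ 2 * 128 * weight Λ t := by
        nlinarith [mul_le_mul_of_nonneg_right hws (sq_nonneg (energy Λ p p₁ t))]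
      have : weight Λ t ≤ energy Λ p p₁ t ^ 2 * 128 := by
        refine le_of_mul_le_mul_right ?_ (by linarith : 0 < weight Λ t)
        linarith
      linarith
    · have hb : energy Λ p p₁ a ^ 2 / (1 - a ^ 2) ≤ 41 * Λ := by
        rw [div_le_iff₀ hsa0]
        have : energy Λ p p₁ a ^ 2 ≤ (9 / 2) ^ 2 :=
          pow_le_pow_left₀ (energy_nonneg hΛ0 haI) (by linarith) 2
        nlinarith
      have hc := hup.trans hb
      rw [div_le_iff₀ hst0] at hc
      linarith

/-- A function whose derivative is `V⁴/D² - p⁴` up to lower-order terms, with `V` the velocity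
and `D` the weight. -/
noncomputable def virial (Λ : ℝ) (p p₁ : ℝ → ℝ) (t : ℝ) : ℝ :=
  (1 - t ^ 2) * (p t * velocity p p₁ t * energy Λ p p₁ t) / weight Λ t ^ 2

/-- The lower-order terms in the derivative of `virial`. -/
noncomputable def virialError (Λ : ℝ) (p p₁ : ℝ → ℝ) (t : ℝ) : ℝ :=
  t * p t * velocity p p₁ t *
    (p t ^ 2 * weight Λ t / 2 + (weight Λ t - 1) * energy Λ p p₁ t) / weight Λ t ^ 3

theorem hasDerivAt_virial (h : IsLegendreSolution Λ p p₁ p₂) {t : ℝ}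
    (ht : t ∈ Set.Icc (0 : ℝ) 1) :
    HasDerivAt (virial Λ p p₁)
      (velocity p p₁ t ^ 4 / weight Λ t ^ 2 - p t ^ 4 + virialError Λ p p₁ t) t := by
  have hw : 0 < weight Λ t := by
    linarith [quarter_le_weight (by linarith [h.six_le] : 0 ≤ Λ) ht]
  refine (((hasDerivAt_one_sub_sq t).mul (((h.hasDerivAt t).mul (h.hasDerivAt_velocity t)).mul
    (h.hasDerivAt_energy t))).div ((hasDerivAt_weight Λ t).pow 2)
      (pow_pos hw 2).ne').congr_deriv ?_
  simp only [Pi.pow_apply, Pi.mul_apply, virialError]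
  push_cast
  have e1 := one_sub_sq_mul_deriv_energy Λ p p₁ t
  have e2 : energy Λ p p₁ t = weight Λ t * p t ^ 2 + velocity p p₁ t ^ 2 := rfl
  have e3 : (Λ + 1 / 4) * (1 - t ^ 2) = weight Λ t - 1 / 4 := by unfold weight; ring
  have e4 : (1 - t ^ 2) * p₁ t = velocity p p₁ t + t * p t / 2 := by unfold velocity; ring
  have e5 : (1 - t ^ 2) * (-(Λ * p t) - p t / 2 - t * p₁ t / 2)
      = -(weight Λ t * p t) - t * velocity p p₁ t / 2 := by
    unfold weight velocity; ring
  set E := energy Λ p p₁ t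
  set w := weight Λ t
  set v := velocity p p₁ t
  generalize -(t * (Λ * p t ^ 2 + (1 - t ^ 2) * p₁ t ^ 2 - t * p t * p₁ t)) = E' at e1 ⊢
  generalize -(Λ * p t) - p t / 2 - t * p₁ t / 2 = v' at e5 ⊢
  have hrhs : v ^ 4 / w ^ 2 - p t ^ 4
        + t * p t * v * (p t ^ 2 * w / 2 + (w - 1) * E) / w ^ 3
      = (v ^ 4 * w ^ 2 - p t ^ 4 * w ^ 4
        + t * p t * v * (p t ^ 2 * w / 2 + (w - 1) * E) * w) / (w ^ 2) ^ 2 := by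
    field_simp
  rw [hrhs]
  congr 1
  linear_combination w ^ 2 * E * v * e4 + w ^ 2 * E * p t * e5 + w ^ 2 * p t * v * e1
    + 4 * p t * v * E * w * t * e3 + w ^ 2 * (v ^ 2 - w * p t ^ 2) * e2

theorem abs_mul_velocity_le (hΛ : 0 ≤ Λ) {t : ℝ} (ht : t ∈ Set.Icc (0 : ℝ) 1) :
    |p t * velocity p p₁ t| ≤ energy Λ p p₁ t * (1 / 28 + 7 / (4 * weight Λ t)) := by
  have hw : 0 < weight Λ t := by linarith [quarter_le_weight hΛ ht]
  have hE := energy_nonneg (p := p) (p₁ := p₁) hΛ ht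
  refine abs_le_of_sq_le_sq ?_ (by positivity)
  have h1 : (p t * velocity p p₁ t) ^ 2 * (4 * weight Λ t) ≤ energy Λ p p₁ t ^ 2 := by
    unfold energy
    nlinarith [sq_nonneg (weight Λ t * p t ^ 2 - velocity p p₁ t ^ 2)]
  have h2 : 1 / (4 * weight Λ t) ≤ (1 / 28 + 7 / (4 * weight Λ t)) ^ 2 := by
    have : (1 / 28 + 7 / (4 * weight Λ t)) ^ 2 - 1 / (4 * weight Λ t)
        = (1 / 28 - 7 / (4 * weight Λ t)) ^ 2 := by ring
    nlinarith [sq_nonneg (1 / 28 - 7 / (4 * weight Λ t))]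
  calc (p t * velocity p p₁ t) ^ 2
      ≤ energy Λ p p₁ t ^ 2 * (1 / (4 * weight Λ t)) := by
        rw [mul_one_div, le_div_iff₀ (by positivity)]; exact h1
    _ ≤ energy Λ p p₁ t ^ 2 * (1 / 28 + 7 / (4 * weight Λ t)) ^ 2 := by gcongr
    _ = _ := by ring

theorem abs_virialError_le (hΛ : 0 ≤ Λ) {t : ℝ} (ht : t ∈ Set.Icc (0 : ℝ) 1) :
    |virialError Λ p p₁ t|
      ≤ (energy Λ p p₁ t / weight Λ t) ^ 2 * (1 / 4 + 49 / (4 * weight Λ t)) := by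
  have hw4 := quarter_le_weight hΛ ht
  have hw : 0 < weight Λ t := by linarith
  have hE := energy_nonneg (p := p) (p₁ := p₁) hΛ ht
  have hpv := abs_mul_velocity_le (p := p) (p₁ := p₁) hΛ ht
  have hp : p t ^ 2 * weight Λ t ≤ energy Λ p p₁ t := by
    unfold energy; nlinarith [sq_nonneg (velocity p p₁ t)]
  have hp0 : 0 ≤ p t ^ 2 * weight Λ t := by positivity
  have hfac : |p t ^ 2 * weight Λ t / 2 + (weight Λ t - 1) * energy Λ p p₁ t|
      ≤ 7 * weight Λ t * energy Λ p p₁ t := by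
    have := mul_le_mul_of_nonneg_right hw4 hE
    rw [abs_le]
    constructor <;> nlinarith
  rw [virialError, abs_div, abs_mul, mul_assoc t, abs_mul t, abs_of_nonneg ht.1,
    abs_of_pos (pow_pos hw 3), div_le_iff₀ (pow_pos hw 3)]
  calc t * |p t * velocity p p₁ t| *
        |p t ^ 2 * weight Λ t / 2 + (weight Λ t - 1) * energy Λ p p₁ t|
      ≤ 1 * (energy Λ p p₁ t * (1 / 28 + 7 / (4 * weight Λ t))) *
        (7 * weight Λ t * energy Λ p p₁ t) := by
        have := ht.2
        gcongr
    _ = _ := by field_simp; ring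

theorem lower_bound_deriv (h : IsLegendreSolution Λ p p₁ p₂) {t : ℝ}
    (ht : t ∈ Set.Icc (0 : ℝ) 1) :
    1 / (512 * weight Λ t) - 533 / weight Λ t ^ 2
      ≤ 2 * p t ^ 4
        + (velocity p p₁ t ^ 4 / weight Λ t ^ 2 - p t ^ 4 + virialError Λ p p₁ t) := by
  have hΛ : 0 ≤ Λ := by linarith [h.six_le]
  have hw : 0 < weight Λ t := by linarith [quarter_le_weight hΛ ht]
  obtain ⟨hlow, hup⟩ := h.energy_sq_bounds ht
  have herr := neg_le_of_abs_le (abs_virialError_le (p := p) (p₁ := p₁) hΛ ht)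
  have hmain : (energy Λ p p₁ t / weight Λ t) ^ 2 / 2
      ≤ p t ^ 4 + velocity p p₁ t ^ 4 / weight Λ t ^ 2 := by
    have e : energy Λ p p₁ t / weight Λ t = p t ^ 2 + velocity p p₁ t ^ 2 / weight Λ t := by
      unfold energy; field_simp
    have e' : velocity p p₁ t ^ 4 / weight Λ t ^ 2
      = (velocity p p₁ t ^ 2 / weight Λ t) ^ 2 := by ring
    rw [e, e']
    nlinarith [sq_nonneg (p t ^ 2 - velocity p p₁ t ^ 2 / weight Λ t)]
  have h1 : 1 / (512 * weight Λ t) ≤ (energy Λ p p₁ t / weight Λ t) ^ 2 * (1 / 4) := by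
    rw [div_pow, div_mul_eq_mul_div, div_le_div_iff₀ (by positivity) (by positivity)]
    nlinarith
  have h2 : (energy Λ p p₁ t / weight Λ t) ^ 2 * (49 / (4 * weight Λ t))
      ≤ 533 / weight Λ t ^ 2 := by
    rw [div_pow, div_mul_div_comm, div_le_div_iff₀ (by positivity) (by positivity)]
    have : 0 < weight Λ t ^ 2 := by positivity
    nlinarith [mul_le_mul_of_nonneg_right hup this.le, pow_pos hw 3]
  linarith

theorem continuous (h : IsLegendreSolution Λ p p₁ p₂) : Continuous p :=
  continuous_iff_continuousAt.2 fun t => (h.hasDerivAt t).continuousAt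

theorem hasDerivAt_integral_pow_four (h : IsLegendreSolution Λ p p₁ p₂) (t : ℝ) :
    HasDerivAt (fun x => ∫ y in (0 : ℝ)..x, p y ^ 4) (p t ^ 4) t :=
  ((h.continuous.pow 4).integral_hasStrictDerivAt 0 t).hasDerivAt

theorem linear_le_weight (hΛ : 0 ≤ Λ) {t : ℝ} (ht : t ∈ Set.Icc (0 : ℝ) 1) :
    (Λ + 1 / 4) * (1 - t) + 1 / 4 ≤ weight Λ t := by
  have : 1 - t ≤ 1 - t ^ 2 := by nlinarith [ht.1, ht.2]
  unfold weight
  gcongr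

theorem weight_le_linear (hΛ : 0 ≤ Λ) {t : ℝ} (ht : t ∈ Set.Icc (0 : ℝ) 1) :
    weight Λ t ≤ 2 * (Λ + 1 / 4) * (1 - t) + 1 / 4 := by
  have : 1 - t ^ 2 ≤ 2 * (1 - t) := by nlinarith [ht.1, ht.2]
  unfold weight
  nlinarith

theorem hasDerivAt_log_linear {c t : ℝ} (hc : c * (1 - t) + 1 / 4 ≠ 0) :
    HasDerivAt (fun t => Real.log (c * (1 - t) + 1 / 4)) (-c / (c * (1 - t) + 1 / 4)) t := by
  refine (((((hasDerivAt_id' t).const_sub 1).const_mul c).add_const (1 / 4)).log hc).congr_deriv ?_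
  ring

theorem hasDerivAt_inv_linear {c t : ℝ} (hc : c * (1 - t) + 1 / 4 ≠ 0) :
    HasDerivAt (fun t => (c * (1 - t) + 1 / 4)⁻¹) (c / (c * (1 - t) + 1 / 4) ^ 2) t := by
  refine (((((hasDerivAt_id' t).const_sub 1).const_mul c).add_const
    (1 / 4)).fun_inv hc).congr_deriv ?_
  ring

theorem integral_le (h : IsLegendreSolution Λ p p₁ p₂) :
    ∫ t in (0 : ℝ)..1, p t ^ 4 ≤ 41 * Real.log (4 * (Λ + 1 / 4) + 1) / (Λ + 1 / 4) := by
  have hΛ : 0 ≤ Λ := by linarith [h.six_le]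
  have hlin : ∀ t ∈ Set.Icc (0 : ℝ) 1, 0 < (Λ + 1 / 4) * (1 - t) + 1 / 4 := fun t ht => by
    have := sub_nonneg.2 ht.2
    positivity
  have hm : MonotoneOn (fun x => 41 / (Λ + 1 / 4) * -Real.log ((Λ + 1 / 4) * (1 - x) + 1 / 4)
      - ∫ y in (0 : ℝ)..x, p y ^ 4) (Set.Icc 0 1) := by
    refine monotoneOn_of_hasDerivAt (fun t ht => (((hasDerivAt_log_linear
      (hlin t ht).ne').neg).const_mul _).sub (h.hasDerivAt_integral_pow_four t)) (fun t ht => ?_)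
    have hw : 0 < weight Λ t := by linarith [quarter_le_weight hΛ ht]
    have h1 : p t ^ 4 ≤ 41 / weight Λ t := by
      rw [le_div_iff₀ hw]
      refine le_of_mul_le_mul_right ?_ hw
      have hp : p t ^ 2 * weight Λ t ≤ energy Λ p p₁ t := by
        unfold energy; nlinarith [sq_nonneg (velocity p p₁ t)]
      calc p t ^ 4 * weight Λ t * weight Λ t = (p t ^ 2 * weight Λ t) ^ 2 := by ring
        _ ≤ energy Λ p p₁ t ^ 2 := by gcongr
        _ ≤ _ := (h.energy_sq_bounds ht).2
    have h2 : 41 / weight Λ t ≤ 41 / ((Λ + 1 / 4) * (1 - t) + 1 / 4) :=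
      div_le_div_of_nonneg_left (by norm_num) (hlin t ht) (linear_le_weight hΛ ht)
    have h3 : 41 / (Λ + 1 / 4) * -(-(Λ + 1 / 4) / ((Λ + 1 / 4) * (1 - t) + 1 / 4))
        = 41 / ((Λ + 1 / 4) * (1 - t) + 1 / 4) := by
      have := hlin t ht
      field_simp
    rw [h3]
    linarith
  have := hm (Set.left_mem_Icc.2 zero_le_one) (Set.right_mem_Icc.2 zero_le_one) zero_le_one
  simp only [integral_same, sub_self, mul_zero, zero_add, sub_zero, mul_one] at this
  have hlog : Real.log (4 * (Λ + 1 / 4) + 1) = Real.log (Λ + 1 / 4 + 1 / 4) - Real.log (1 / 4) := by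
    rw [← Real.log_div (by positivity) (by norm_num)]
    congr 1
    ring
  rw [hlog, mul_div_right_comm]
  linarith

theorem le_integral (h : IsLegendreSolution Λ p p₁ p₂) :
    (Real.log (8 * (Λ + 1 / 4) + 1) / 2048 - 1230) / (Λ + 1 / 4) ≤ ∫ t in (0 : ℝ)..1, p t ^ 4 := by
  have hΛ : 0 ≤ Λ := by linarith [h.six_le]
  have hlin : ∀ c : ℝ, 0 ≤ c → ∀ t ∈ Set.Icc (0 : ℝ) 1, 0 < c * (1 - t) + 1 / 4 :=
    fun c hc t ht => by
      have := sub_nonneg.2 ht.2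
      positivity
  obtain ⟨L, hL⟩ : ∃ L, L = Λ + 1 / 4 := ⟨_, rfl⟩
  have hL0 : 0 < L := by linarith
  have hm : MonotoneOn (fun x => 2 * (∫ y in (0 : ℝ)..x, p y ^ 4) + virial Λ p p₁ x
      + (1 / (1024 * L) * Real.log (2 * L * (1 - x) + 1 / 4)
        + 533 / L * (L * (1 - x) + 1 / 4)⁻¹)) (Set.Icc 0 1) := by
    refine monotoneOn_of_hasDerivAt (fun t ht =>
      (((h.hasDerivAt_integral_pow_four t).const_mul 2).add (h.hasDerivAt_virial ht)).add
      (((hasDerivAt_log_linear (hlin (2 * L) (by linarith) t ht).ne').const_mul _).add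
      ((hasDerivAt_inv_linear (hlin L hL0.le t ht).ne').const_mul _))) (fun t ht => ?_)
    have hw : 0 < weight Λ t := by linarith [quarter_le_weight hΛ ht]
    have l1 := hlin L hL0.le t ht
    have l2 := hlin (2 * L) (by linarith) t ht
    have h1 := h.lower_bound_deriv ht
    have h2 : 1 / (512 * (2 * L * (1 - t) + 1 / 4)) ≤ 1 / (512 * weight Λ t) := by
      have := weight_le_linear hΛ ht
      rw [← hL] at this
      gcongr
    have h3 : 533 / weight Λ t ^ 2 ≤ 533 / (L * (1 - t) + 1 / 4) ^ 2 := by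
      have := linear_le_weight hΛ ht
      rw [← hL] at this
      gcongr
    have h4 : 1 / (1024 * L) * (-(2 * L) / (2 * L * (1 - t) + 1 / 4))
        = -(1 / (512 * (2 * L * (1 - t) + 1 / 4))) := by
      field_simp
      norm_num
    have h5 : 533 / L * (L / (L * (1 - t) + 1 / 4) ^ 2) = 533 / (L * (1 - t) + 1 / 4) ^ 2 := by
      field_simp
    rw [h4, h5]
    linarith
  have zero_mem : (0 : ℝ) ∈ Set.Icc (0 : ℝ) 1 := Set.left_mem_Icc.2 zero_le_one
  have hI := hm zero_mem (Set.right_mem_Icc.2 zero_le_one) zero_le_one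
  have hv1 : virial Λ p p₁ 1 = 0 := by simp [virial]
  have hv0 : -(328 / L) ≤ virial Λ p p₁ 0 := by
    have hw4 := quarter_le_weight hΛ zero_mem
    have hw : 0 < weight Λ 0 := by linarith
    have hE := energy_nonneg (p := p) (p₁ := p₁) hΛ zero_mem
    have hwL : L ≤ weight Λ 0 := by simp only [weight, hL]; linarith
    have hpv : |p 0 * velocity p p₁ 0| ≤ 8 * energy Λ p p₁ 0 := by
      have h7 : 7 / (4 * weight Λ 0) ≤ 7 := by
        rw [div_le_iff₀ (by positivity)]; linarith
      nlinarith [abs_mul_velocity_le (p := p) (p₁ := p₁) hΛ zero_mem]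
    refine neg_le_of_abs_le ?_
    rw [virial, abs_div, abs_of_pos (pow_pos hw 2), abs_mul, abs_mul, abs_of_nonneg hE]
    calc _ ≤ 1 * (8 * energy Λ p p₁ 0 * energy Λ p p₁ 0) / weight Λ 0 ^ 2 := by
          gcongr
          norm_num
      _ = 8 * energy Λ p p₁ 0 ^ 2 / weight Λ 0 ^ 2 := by ring
      _ ≤ 8 * (41 * weight Λ 0) / weight Λ 0 ^ 2 := by
          gcongr
          exact (h.energy_sq_bounds zero_mem).2
      _ = 328 / weight Λ 0 := by field_simp; norm_num
      _ ≤ 328 / L := by gcongr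
  simp only [integral_same, sub_self, mul_zero, zero_add, sub_zero, mul_one, hv1] at hI
  have hlog : Real.log (8 * L + 1) = Real.log (2 * L + 1 / 4) - Real.log (1 / 4) := by
    rw [← Real.log_div (by positivity) (by norm_num)]
    congr 1
    ring
  have hinv : 0 ≤ 533 / L * (L + 1 / 4)⁻¹ := by positivity
  rw [← hL, hlog]
  have e : ((Real.log (2 * L + 1 / 4) - Real.log (1 / 4)) / 2048 - 1230) / L
      = (1 / (1024 * L) * Real.log (2 * L + 1 / 4) - 1 / (1024 * L) * Real.log (1 / 4)
        - 533 / L * (1 / 4)⁻¹ - 328 / L) / 2 := by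
    field_simp
    ring
  rw [e]
  linarith

theorem integral_pos (h : IsLegendreSolution Λ p p₁ p₂) : 0 < ∫ t in (0 : ℝ)..1, p t ^ 4 :=
  intervalIntegral.integral_pos zero_lt_one (h.continuous.pow 4).continuousOn
    (fun _ _ => by positivity) ⟨1, Set.right_mem_Icc.2 zero_le_one, by simp [h.eval_one]⟩

end IsLegendreSolution

theorem integral_legendreP_pow_four_le {l : ℕ} (hl : 2 ≤ l) :
    ∫ t in (0 : ℝ)..1, (legendreP l).eval t ^ 4 ≤ 205 * Real.log l / (l : ℝ) ^ 2 := by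
  have hl' : (2 : ℝ) ≤ l := by exact_mod_cast hl
  refine (IsLegendreSolution.of_legendreP hl).integral_le.trans ?_
  have hlog : Real.log (4 * ((l : ℝ) * (l + 1) + 1 / 4) + 1) ≤ 5 * Real.log l := by
    have e : 5 * Real.log (l : ℝ) = Real.log ((l : ℝ) ^ 5) := by rw [Real.log_pow]; norm_num
    rw [e]
    refine Real.log_le_log (by positivity) ?_
    have h3 : (2 : ℝ) ^ 3 ≤ (l : ℝ) ^ 3 := by gcongr
    nlinarith [mul_le_mul_of_nonneg_right h3 (sq_nonneg (l : ℝ))]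
  have h0 : 0 ≤ Real.log (l : ℝ) := Real.log_nonneg (by linarith)
  have h1 : 41 * Real.log (4 * ((l : ℝ) * (l + 1) + 1 / 4) + 1) ≤ 205 * Real.log l := by linarith
  have h2 : (l : ℝ) ^ 2 ≤ l * (l + 1) + 1 / 4 := by nlinarith
  gcongr

theorem le_integral_legendreP_pow_four {l : ℕ} (hl : 2 ≤ l)
    (hlog : 2519040 ≤ Real.log l) :
    1 / 4096 * Real.log l / (l : ℝ) ^ 2 ≤ ∫ t in (0 : ℝ)..1, (legendreP l).eval t ^ 4 := by
  have hl' : (2 : ℝ) ≤ l := by exact_mod_cast hl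
  refine le_trans ?_ (IsLegendreSolution.of_legendreP hl).le_integral
  have h1 : 2 * Real.log l ≤ Real.log (8 * ((l : ℝ) * (l + 1) + 1 / 4) + 1) := by
    have e : 2 * Real.log (l : ℝ) = Real.log ((l : ℝ) ^ 2) := by rw [Real.log_pow]; norm_num
    rw [e]
    exact Real.log_le_log (by positivity) (by nlinarith)
  rw [div_le_div_iff₀ (by positivity) (by positivity)]
  have h2 : (l : ℝ) * (l + 1) + 1 / 4 ≤ 2 * (l : ℝ) ^ 2 := by nlinarith
  calc 1 / 4096 * Real.log l * ((l : ℝ) * (l + 1) + 1 / 4)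
      ≤ 1 / 4096 * Real.log l * (2 * (l : ℝ) ^ 2) := by gcongr
    _ = Real.log l / 2048 * (l : ℝ) ^ 2 := by ring
    _ ≤ _ := by
      gcongr
      linarith

theorem exists_forall_lt_log_div_sq_le (N : ℕ) :
    ∃ M : ℝ, ∀ l < N, 2 ≤ l →
      Real.log l / (l : ℝ) ^ 2 ≤ M * ∫ t in (0 : ℝ)..1, (legendreP l).eval t ^ 4 := by
  obtain ⟨M, hM⟩ := ((Finset.range N).image fun l : ℕ => Real.log l / (l : ℝ) ^ 2 /
    ∫ t in (0 : ℝ)..1, (legendreP l).eval t ^ 4).exists_le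
  refine ⟨M, fun l hlN hl => ?_⟩
  rw [← div_le_iff₀ (IsLegendreSolution.of_legendreP hl).integral_pos]
  exact hM _ (Finset.mem_image_of_mem _ (Finset.mem_range.2 hlN))

/-- two-sided bound `C' log l / l² ≤ ∫_0^1 P_l(t)^4 dt ≤ C log l / l²` for `l ≥ 2`. -/
theorem legendre_fourth_moment :
    ∃ C > (0:ℝ), ∃ C' > (0:ℝ), ∀ l : ℕ, 2 ≤ l →
      C' * Real.log l / (l : ℝ) ^ 2 ≤ (∫ t in (0:ℝ)..1, (legendreP l).eval t ^ 4) ∧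
      (∫ t in (0:ℝ)..1, (legendreP l).eval t ^ 4) ≤ C * Real.log l / (l : ℝ) ^ 2 := by
  obtain ⟨N, hN⟩ := Filter.eventually_atTop.1
    ((Real.tendsto_log_atTop.comp tendsto_natCast_atTop_atTop).eventually_ge_atTop 2519040)
  obtain ⟨M, hM⟩ := exists_forall_lt_log_div_sq_le N
  have hmax : 0 < max M 4096 := lt_max_of_lt_right (by norm_num)
  refine ⟨205, by norm_num, 1 / max M 4096, by positivity, fun l hl =>
    ⟨?_, integral_legendreP_pow_four_le hl⟩⟩
  have hpos := (IsLegendreSolution.of_legendreP hl).integral_pos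
  rw [mul_div_assoc, one_div_mul_eq_div, div_le_iff₀' hmax]
  rcases lt_or_ge l N with hlN | hlN
  · exact (hM l hlN hl).trans (mul_le_mul_of_nonneg_right (le_max_left _ _) hpos.le)
  · have := le_integral_legendreP_pow_four hl (hN l hlN)
    calc Real.log l / (l : ℝ) ^ 2 = 4096 * (1 / 4096 * Real.log l / (l : ℝ) ^ 2) := by ring
      _ ≤ 4096 * ∫ t in (0 : ℝ)..1, (legendreP l).eval t ^ 4 := by gcongr
      _ ≤ _ := mul_le_mul_of_nonneg_right (le_max_right _ _) hpos.le
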